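/- A polynomial p ∈ ℂ[x,y] satisfies g(p) = p if and only if p lies in the ℂ-subalgebra of ℂ[x,y] generated by the set {x^r, x^{r−a} y, y^r} ∪ { x^{i_{t−1} − s i_t} y^{s j_t − j_{t−1}} : 1 ≤ t ≤ n, 2 ≤ s ≤ α_t − 1 }. In other words, these monomials generate the invariant ring R = ℂ[x,y]^{(1/r)(1,a)} as a ℂ-algebra. -/

import Mathlib

open MvPolynomial

/-- The two-step linear recursion `s₀ = x0`, `s₁ = x1`, `s_{t+1} = α_t s_t − s_{t−1}`;
with `x0 = r, x1 = a` this is the i-series and with `x0 = 0, x1 = 1` the j-series. -/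
def ser (x0 x1 : ℤ) (α : ℕ → ℕ) : ℕ → ℤ
  | 0 => x0
  | 1 => x1
  | t + 2 => (α (t + 1) : ℤ) * ser x0 x1 α (t + 1) - ser x0 x1 α t

/-- Hirzebruch–Jung (negative) continued fraction value of a list. -/
def hj : List ℚ → ℚ
  | [] => 0
  | q :: L => q - 1 / hj L

section Series

variable {α : ℕ → ℕ}

theorem ser_succ_succ (x0 x1 : ℤ) (α : ℕ → ℕ) (t : ℕ) :
    ser x0 x1 α (t + 2) = (α (t + 1) : ℤ) * ser x0 x1 α (t + 1) - ser x0 x1 α t := rfl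

/-- The Wronskian of the i-series and the j-series is constant. -/
theorem ser_wronskian (r a : ℤ) (α : ℕ → ℕ) (t : ℕ) :
    ser r a α t * ser 0 1 α (t + 1) - ser r a α (t + 1) * ser 0 1 α t = r := by
  induction t with
  | zero => simp [ser]
  | succ t ih => rw [ser_succ_succ, ser_succ_succ]; linear_combination ih

theorem dvd_ser_sub (r a : ℤ) (α : ℕ → ℕ) (t : ℕ) :
    r ∣ ser r a α t - a * ser 0 1 α t ∧
      r ∣ ser r a α (t + 1) - a * ser 0 1 α (t + 1) := by
  induction t with
  | zero => simp [ser]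
  | succ t ih =>
    obtain ⟨⟨c, hc⟩, ⟨d, hd⟩⟩ := ih
    refine ⟨⟨d, hd⟩, α (t + 1) * d - c, ?_⟩
    rw [ser_succ_succ, ser_succ_succ]
    linear_combination (α (t + 1) : ℤ) * hd - hc

theorem isCoprime_ser {r a : ℤ} (h : IsCoprime r a) (α : ℕ → ℕ) (t : ℕ) :
    IsCoprime (ser r a α t) (ser r a α (t + 1)) := by
  induction t with
  | zero => exact h
  | succ t ih =>
    obtain ⟨u, v, huv⟩ := ih
    refine ⟨v + u * α (t + 1), -u, ?_⟩
    rw [ser_succ_succ]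
    linear_combination huv

/-- The j-series is nonnegative and strictly increasing. -/
theorem ser_zero_one_nonneg_lt {n : ℕ} (hα : ∀ t, 1 ≤ t → t ≤ n → 2 ≤ α t) :
    ∀ t ≤ n, 0 ≤ ser 0 1 α t ∧ ser 0 1 α t < ser 0 1 α (t + 1) := by
  intro t
  induction t with
  | zero => simp [ser]
  | succ t ih =>
    intro ht
    obtain ⟨h1, h2⟩ := ih (by omega)
    have h3 : (2 : ℤ) ≤ α (t + 1) := by exact_mod_cast hα (t + 1) (by omega) ht
    rw [ser_succ_succ]
    constructor <;> nlinarith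

theorem hj_map_range_succ (α : ℕ → ℕ) (t m : ℕ) :
    hj ((List.range (m + 1)).map fun k => (α (t + k + 1) : ℚ)) =
      α (t + 1) - 1 / hj ((List.range m).map fun k => (α (t + 1 + k + 1) : ℚ)) := by
  rw [List.range_succ_eq_map, List.map_cons, List.map_map, hj]
  congr 4
  funext k
  simp only [Function.comp]
  congr 2
  omega

theorem one_lt_hj {n : ℕ} (hα : ∀ t, 1 ≤ t → t ≤ n → 2 ≤ α t) (m : ℕ) :
    ∀ t, t + (m + 1) ≤ n → 1 < hj ((List.range (m + 1)).map fun k => (α (t + k + 1) : ℚ)) := by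
  induction m with
  | zero =>
    intro t ht
    have : (2 : ℚ) ≤ α (t + 1) := by exact_mod_cast hα (t + 1) (by omega) (by omega)
    rw [hj_map_range_succ]
    simp only [List.range_zero, List.map_nil, hj, div_zero, sub_zero]
    linarith
  | succ m ih =>
    intro t ht
    have h2 : (2 : ℚ) ≤ α (t + 1) := by exact_mod_cast hα (t + 1) (by omega) (by omega)
    have h1 := ih (t + 1) (by omega)
    rw [hj_map_range_succ]
    have := (div_lt_one (by linarith)).2 h1
    linarith

theorem hj_eq_ser_div {r a n : ℕ} (hα : ∀ t, 1 ≤ t → t ≤ n → 2 ≤ α t) (ha : 1 ≤ a) (har : a < r)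
    (hval : hj ((List.range n).map fun t => (α (t + 1) : ℚ)) = (r : ℚ) / (a : ℚ)) :
    ∀ t m, t + (m + 1) = n →
      hj ((List.range (m + 1)).map fun k => (α (t + k + 1) : ℚ)) =
          (ser r a α t : ℚ) / (ser r a α (t + 1) : ℚ) ∧
        0 < ser r a α (t + 1) ∧ ser r a α (t + 1) < ser r a α t := by
  intro t
  induction t with
  | zero =>
    rintro m rfl
    refine ⟨?_, by simp [ser]; omega, by simp [ser]; omega⟩
    simp only [zero_add] at hval ⊢
    simpa [ser] using hval
  | succ t ih =>
    intro m hm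
    obtain ⟨h1, h2, h3⟩ := ih (m + 1) (by omega)
    have hgt := one_lt_hj hα m (t + 1) hm.le
    rw [hj_map_range_succ] at h1
    set H := hj ((List.range (m + 1)).map fun k => (α (t + 1 + k + 1) : ℚ))
    have hpos : (0 : ℚ) < ser r a α (t + 1) := by exact_mod_cast h2
    have hH0 : H ≠ 0 := by positivity
    have key : (ser r a α (t + 1 + 1) : ℚ) * H = ser r a α (t + 1) := by
      rw [ser_succ_succ]
      push_cast
      field_simp at h1
      linear_combination h1
    have hpos' : (0 : ℚ) < ser r a α (t + 1 + 1) := by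
      by_contra hcon
      nlinarith
    refine ⟨?_, by exact_mod_cast hpos', ?_⟩
    · rw [eq_div_iff hpos'.ne', mul_comm, key]
    · have : (ser r a α (t + 1 + 1) : ℚ) < ser r a α (t + 1) := by nlinarith
      exact_mod_cast this

theorem ser_last {r a n : ℕ} (hn : 1 ≤ n) (hα : ∀ t, 1 ≤ t → t ≤ n → 2 ≤ α t) (ha : 1 ≤ a)
    (har : a < r) (hcop : Nat.Coprime r a)
    (hval : hj ((List.range n).map fun t => (α (t + 1) : ℚ)) = (r : ℚ) / (a : ℚ)) :
    ser r a α n = 1 ∧ ser r a α (n + 1) = 0 ∧ ser 0 1 α (n + 1) = r := by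
  obtain ⟨t, rfl⟩ : ∃ t, n = t + 1 := ⟨n - 1, by omega⟩
  obtain ⟨h1, h2, h3⟩ := hj_eq_ser_div hα ha har hval t 0 (by omega)
  have hpos : (0 : ℚ) < ser r a α (t + 1) := by exact_mod_cast h2
  have h0 : ser r a α (t + 1 + 1) = 0 := by
    rw [hj_map_range_succ, eq_div_iff hpos.ne'] at h1
    simp only [List.range_zero, List.map_nil, hj, div_zero, sub_zero] at h1
    have h4 : (α (t + 1) : ℤ) * ser r a α (t + 1) = ser r a α t := by exact_mod_cast h1
    rw [ser_succ_succ, h4, sub_self]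
  have hu := isCoprime_ser (Nat.isCoprime_iff_coprime.2 hcop) α (t + 1)
  rw [h0, isCoprime_zero_right] at hu
  have h1' : ser r a α (t + 1) = 1 := by
    rcases Int.isUnit_iff.1 hu with h | h <;> omega
  have hw := ser_wronskian r a α (t + 1)
  rw [h0, h1'] at hw
  exact ⟨h1', h0, by linarith⟩

end Series

section Cone

/-- The lattice points of the cone spanned by `P` and `Q` are generated by `P` and `Q`, provided
these form a basis of the lattice `{(u, v) : r ∣ u + a v}` of index `r`. -/
theorem mem_of_mem_cone {r a : ℤ} (hr : 0 < r) (S : AddSubmonoid (ℤ × ℤ)) {P Q q : ℤ × ℤ}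
    (hP : P ∈ S) (hQ : Q ∈ S) (hPr : r ∣ P.1 + a * P.2) (hQr : r ∣ Q.1 + a * Q.2)
    (hqr : r ∣ q.1 + a * q.2) (hdet : P.1 * Q.2 - Q.1 * P.2 = r)
    (h1 : q.1 * P.2 ≤ q.2 * P.1) (h2 : q.2 * Q.1 ≤ q.1 * Q.2) : q ∈ S := by
  obtain ⟨p', hp⟩ := hPr
  obtain ⟨q', hq⟩ := hQr
  obtain ⟨k, hk⟩ := hqr
  set d := q.2 * p' - k * P.2
  set c := k * Q.2 - q.2 * q'
  have hd : r * d = q.2 * P.1 - q.1 * P.2 := by linear_combination P.2 * hk - q.2 * hp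
  have hc : r * c = q.1 * Q.2 - q.2 * Q.1 := by linear_combination q.2 * hq - Q.2 * hk
  have hd0 : 0 ≤ d := nonneg_of_mul_nonneg_right (by linarith) hr
  have hc0 : 0 ≤ c := nonneg_of_mul_nonneg_right (by linarith) hr
  have key : q = c.toNat • P + d.toNat • Q := by
    ext
    · simp only [Prod.fst_add, Prod.smul_fst, ← natCast_zsmul, Int.toNat_of_nonneg, hd0, hc0,
        smul_eq_mul]
      apply mul_left_cancel₀ hr.ne'
      linear_combination -P.1 * hc - Q.1 * hd - q.1 * hdet
    · simp only [Prod.snd_add, Prod.smul_snd, ← natCast_zsmul, Int.toNat_of_nonneg, hd0, hc0,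
        smul_eq_mul]
      apply mul_left_cancel₀ hr.ne'
      linear_combination -P.2 * hc - Q.2 * hd - q.2 * hdet
  rw [key]
  exact S.add_mem (S.nsmul_mem hP _) (S.nsmul_mem hQ _)

/-- The exponent vector `(i_t − s i_{t+1}, s j_{t+1} − j_t)`. -/
def expVec (r a : ℤ) (α : ℕ → ℕ) (t : ℕ) (s : ℤ) : ℤ × ℤ :=
  (ser r a α t - s * ser r a α (t + 1), s * ser 0 1 α (t + 1) - ser 0 1 α t)

theorem dvd_expVec (r a : ℤ) (α : ℕ → ℕ) (t : ℕ) (s : ℤ) :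
    r ∣ (expVec r a α t s).1 + a * (expVec r a α t s).2 := by
  obtain ⟨⟨c, hc⟩, ⟨d, hd⟩⟩ := dvd_ser_sub r a α t
  exact ⟨c - s * d, by simp only [expVec]; linear_combination hc - s * hd⟩

theorem expVec_det (r a : ℤ) (α : ℕ → ℕ) (t : ℕ) (s : ℤ) :
    (expVec r a α t s).1 * (expVec r a α t (s + 1)).2 -
      (expVec r a α t (s + 1)).1 * (expVec r a α t s).2 = r := by
  simp only [expVec]
  linear_combination ser_wronskian r a α t

theorem expVec_succ_one (r a : ℤ) (α : ℕ → ℕ) (t : ℕ) :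
    expVec r a α (t + 1) 1 = expVec r a α t (α (t + 1) - 1) := by
  simp only [expVec, ser_succ_succ]
  ext <;> ring

/-- `P` lies in `S` together with all nonnegative lattice points on the side of the ray through `P`
that contains `(1, 0)`. -/
def ConeBelow (r a : ℤ) (S : AddSubmonoid (ℤ × ℤ)) (P : ℤ × ℤ) : Prop :=
  P ∈ S ∧ ∀ q : ℤ × ℤ, 0 ≤ q.1 → 0 ≤ q.2 → r ∣ q.1 + a * q.2 → q.2 * P.1 ≤ q.1 * P.2 → q ∈ S

theorem ConeBelow.step {r a : ℤ} (hr : 0 < r) {S : AddSubmonoid (ℤ × ℤ)} {α : ℕ → ℕ} {t : ℕ}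
    {s : ℤ} (h : ConeBelow r a S (expVec r a α t s)) (hmem : expVec r a α t (s + 1) ∈ S) :
    ConeBelow r a S (expVec r a α t (s + 1)) := by
  refine ⟨hmem, fun q hq1 hq2 hq hle => ?_⟩
  rcases le_total (q.2 * (expVec r a α t s).1) (q.1 * (expVec r a α t s).2) with h' | h'
  · exact h.2 q hq1 hq2 hq h'
  · exact mem_of_mem_cone hr S h.1 hmem (dvd_expVec ..) (dvd_expVec ..) hq (expVec_det ..) h' hle

theorem ConeBelow.of_mem_range {r a : ℤ} (hr : 0 < r) {S : AddSubmonoid (ℤ × ℤ)} {α : ℕ → ℕ}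
    {t : ℕ} (h : ConeBelow r a S (expVec r a α t 1)) {m : ℕ}
    (hmem : ∀ s : ℕ, 2 ≤ s → s ≤ m + 1 → expVec r a α t s ∈ S) :
    ConeBelow r a S (expVec r a α t (m + 1 : ℕ)) := by
  induction m with
  | zero => simpa using h
  | succ m ih =>
    have h' := ih fun s h2 hs => hmem s h2 (by omega)
    have h'' := hmem (m + 1 + 1) (by omega) le_rfl
    rw [Nat.cast_succ (m + 1)] at h'' ⊢
    exact h'.step hr h''

theorem ConeBelow.base {r a : ℤ} (hr : 0 < r) {S : AddSubmonoid (ℤ × ℤ)} (α : ℕ → ℕ)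
    (h : (r, 0) ∈ S) : ConeBelow r a S (expVec r a α 0 0) := by
  have he : expVec r a α 0 0 = (r, 0) := by simp [expVec, ser]
  rw [he]
  refine ⟨h, ?_⟩
  rintro ⟨u, v⟩ hu hv ⟨k, hk⟩ hle
  simp only [mul_zero] at hu hv hk hle
  have hv0 : v = 0 := le_antisymm (nonpos_of_mul_nonpos_left hle hr) hv
  subst hv0
  simp only [mul_zero, add_zero] at hk
  have hk0 : 0 ≤ k := nonneg_of_mul_nonneg_right (hk ▸ hu) hr
  have : ((u, 0) : ℤ × ℤ) = k.toNat • (r, 0) := by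
    ext <;> simp [hk0, hk, mul_comm]
  rw [this]
  exact S.nsmul_mem h _

theorem coneBelow_expVec_one {r a : ℤ} (hr : 0 < r) {S : AddSubmonoid (ℤ × ℤ)} {α : ℕ → ℕ} {n : ℕ}
    (hα : ∀ t, 1 ≤ t → t ≤ n → 2 ≤ α t) (h0 : (r, 0) ∈ S) (h1 : (r - a, 1) ∈ S)
    (hmem : ∀ t s : ℕ, t < n → 2 ≤ s → s + 1 ≤ α (t + 1) → expVec r a α t s ∈ S) :
    ∀ t ≤ n, ConeBelow r a S (expVec r a α t 1) := by
  intro t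
  induction t with
  | zero =>
    intro _
    have he : expVec r a α 0 (0 + 1) = (r - a, 1) := by simp [expVec, ser]
    simpa using (ConeBelow.base hr α h0).step hr (he ▸ h1)
  | succ t ih =>
    intro ht
    have h2 := hα (t + 1) (by omega) ht
    have := (ih (by omega)).of_mem_range hr (m := α (t + 1) - 2)
      fun s hs hs' => hmem t s ht hs (by omega)
    rw [expVec_succ_one]
    convert this using 2
    omega

/-- A submonoid containing the exponents of all listed generators contains every nonnegative
lattice point. -/
theorem mem_of_expVec_mem {r a n : ℕ} {α : ℕ → ℕ} (ha : 1 ≤ a) (har : a < r)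
    (hcop : Nat.Coprime r a) (hn : 1 ≤ n) (hα : ∀ t, 1 ≤ t → t ≤ n → 2 ≤ α t)
    (hval : hj ((List.range n).map fun t => (α (t + 1) : ℚ)) = (r : ℚ) / (a : ℚ))
    {S : AddSubmonoid (ℤ × ℤ)} (h0 : ((r : ℤ), (0 : ℤ)) ∈ S) (h1 : ((r : ℤ) - a, (1 : ℤ)) ∈ S)
    (hlast : ((0 : ℤ), (r : ℤ)) ∈ S)
    (hmem : ∀ t s : ℕ, t < n → 2 ≤ s → s + 1 ≤ α (t + 1) → expVec r a α t s ∈ S)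
    {q : ℤ × ℤ} (hq1 : 0 ≤ q.1) (hq2 : 0 ≤ q.2) (hq : (r : ℤ) ∣ q.1 + a * q.2) : q ∈ S := by
  have hr : (0 : ℤ) < r := by omega
  obtain ⟨-, hi, hj⟩ := ser_last hn hα ha har hcop hval
  have hcone := coneBelow_expVec_one hr hα h0 h1 hmem n le_rfl
  obtain ⟨t, rfl⟩ : ∃ t, n = t + 1 := ⟨n - 1, by omega⟩
  rw [expVec_succ_one] at hcone
  have hend : expVec r a α t (α (t + 1) - 1 + 1) = (0, (r : ℤ)) := by
    rw [ser_succ_succ] at hi hj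
    ext <;> simp only [expVec] <;> linarith
  have := hcone.step hr (hend ▸ hlast)
  rw [hend] at this
  exact this.2 q hq1 hq2 hq (by simpa using mul_nonneg hq1 hr.le)

end Cone

section Invariants

/-- The exponent vectors of the monomials lying in a subalgebra of `ℂ[x, y]`. -/
def monomialExponents (A : Subalgebra ℂ (MvPolynomial (Fin 2) ℂ)) : AddSubmonoid (ℤ × ℤ) where
  carrier := {q | 0 ≤ q.1 ∧ 0 ≤ q.2 ∧
    (X 0 ^ q.1.toNat * X 1 ^ q.2.toNat : MvPolynomial (Fin 2) ℂ) ∈ A}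
  zero_mem' := by simp [A.one_mem]
  add_mem' := by
    rintro p q ⟨hp1, hp2, hp⟩ ⟨hq1, hq2, hq⟩
    refine ⟨add_nonneg hp1 hq1, add_nonneg hp2 hq2, ?_⟩
    rw [Prod.fst_add, Prod.snd_add, Int.toNat_add hp1 hq1, Int.toNat_add hp2 hq2, pow_add, pow_add,
      mul_mul_mul_comm]
    exact A.mul_mem hp hq

theorem monomial_fin_two (d : Fin 2 →₀ ℕ) (c : ℂ) :
    monomial d c = C c * (X 0 ^ d 0 * X 1 ^ d 1) := by
  rw [monomial_eq, Finsupp.prod_fintype _ _ (by simp), Fin.prod_univ_two]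

variable {ε : ℂ} {a : ℕ} {g : MvPolynomial (Fin 2) ℂ ≃ₐ[ℂ] MvPolynomial (Fin 2) ℂ}

theorem map_X_pow_mul_X_pow (hgx : g (X 0) = C ε * X 0) (hgy : g (X 1) = C (ε ^ a) * X 1)
    (u v : ℕ) : g (X 0 ^ u * X 1 ^ v) = C (ε ^ (u + a * v)) * (X 0 ^ u * X 1 ^ v) := by
  rw [map_mul, map_pow, map_pow, hgx, hgy]
  simp only [C_pow]
  ring

theorem coeff_diagonal_action (hgx : g (X 0) = C ε * X 0) (hgy : g (X 1) = C (ε ^ a) * X 1)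
    (p : MvPolynomial (Fin 2) ℂ) (d : Fin 2 →₀ ℕ) :
    coeff d (g p) = ε ^ (d 0 + a * d 1) * coeff d p := by
  induction p using MvPolynomial.induction_on' with
  | monomial e c =>
    have : g (monomial e c) = C (ε ^ (e 0 + a * e 1)) * monomial e c := by
      rw [monomial_fin_two, map_mul, map_X_pow_mul_X_pow hgx hgy, ← algebraMap_eq, g.commutes]
      ring
    rw [this, coeff_C_mul, coeff_monomial]
    split_ifs with h
    · rw [h]
    · simp
  | add p q hp hq => rw [map_add, coeff_add, hp, hq, coeff_add, mul_add]

end Invariants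

/-- a polynomial `p ∈ ℂ[x,y]` is invariant under the action of
`(1/r)(1,a)` if and only if it lies in the ℂ-subalgebra generated by
`x^r`, `x^{r−a}y`, `y^r` and the monomials `x^{i_{t−1} − s i_t} y^{s j_t − j_{t−1}}`
for `1 ≤ t ≤ n`, `2 ≤ s ≤ α_t − 1`. -/
theorem stmt_3 (r a n : ℕ) (α : ℕ → ℕ)
    (ha : 1 ≤ a) (har : a < r) (hcop : Nat.Coprime r a) (hn : 1 ≤ n)
    (hα : ∀ t, 1 ≤ t → t ≤ n → 2 ≤ α t)
    (hval : hj ((List.range n).map fun t => (α (t + 1) : ℚ)) = (r : ℚ) / (a : ℚ))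
    (ε : ℂ) (hε : IsPrimitiveRoot ε r)
    (g : MvPolynomial (Fin 2) ℂ ≃ₐ[ℂ] MvPolynomial (Fin 2) ℂ)
    (hgx : g (X 0) = C ε * X 0) (hgy : g (X 1) = C (ε ^ a) * X 1) :
    ∀ p : MvPolynomial (Fin 2) ℂ, g p = p ↔
      p ∈ Algebra.adjoin ℂ
        ({X 0 ^ r, X 0 ^ (r - a) * X 1, X 1 ^ r} ∪
          {q : MvPolynomial (Fin 2) ℂ | ∃ t s : ℕ, 1 ≤ t ∧ t ≤ n ∧ 2 ≤ s ∧ s ≤ α t - 1 ∧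
            q = X 0 ^ (ser r a α (t - 1) - (s : ℤ) * ser r a α t).toNat *
                X 1 ^ ((s : ℤ) * ser 0 1 α t - ser 0 1 α (t - 1)).toNat}) := by
  have hr : (0 : ℤ) < r := by omega
  have hinv : ∀ u v : ℕ, (r : ℤ) ∣ u + a * v →
      g (X 0 ^ u * X 1 ^ v) = X 0 ^ u * X 1 ^ v := by
    intro u v h
    rw [map_X_pow_mul_X_pow hgx hgy, (hε.pow_eq_one_iff_dvd _).2 (by exact_mod_cast h), C_1,
      one_mul]
  have hnonneg : ∀ t s : ℕ, t < n → 2 ≤ s → s + 1 ≤ α (t + 1) →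
      0 ≤ (expVec r a α t s).1 ∧ 0 ≤ (expVec r a α t s).2 := by
    intro t s ht hs hsα
    obtain ⟨hj0, hj1⟩ := ser_zero_one_nonneg_lt hα t ht.le
    obtain ⟨-, hi0, hi1⟩ := hj_eq_ser_div hα ha har hval t (n - t - 1) (by omega)
    have hi2 : ser r a α (t + 2) ≤ ser r a α (t + 1) := by
      rcases Nat.lt_or_ge (t + 1) n with h | h
      · exact (hj_eq_ser_div hα ha har hval (t + 1) (n - t - 2) (by omega)).2.2.le
      · obtain rfl : n = t + 1 := by omega
        rw [(ser_last hn hα ha har hcop hval).2.1]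
        exact hi0.le
    rw [ser_succ_succ] at hi2
    have hs' : (s : ℤ) + 1 ≤ α (t + 1) := by exact_mod_cast hsα
    have hs2 : (2 : ℤ) ≤ s := by exact_mod_cast hs
    simp only [expVec]
    constructor <;> nlinarith
  intro p
  constructor
  · intro hp
    rw [p.as_sum]
    refine Subalgebra.sum_mem _ fun d hd => ?_
    have hd0 : coeff d p ≠ 0 := mem_support_iff.1 hd
    have hc := coeff_diagonal_action hgx hgy p d
    rw [hp] at hc
    have hdvd : r ∣ d 0 + a * d 1 :=
      (hε.pow_eq_one_iff_dvd _).1 (mul_right_cancel₀ hd0 (by rw [← hc, one_mul]))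
    rw [monomial_fin_two, ← smul_eq_C_mul]
    refine Subalgebra.smul_mem _ ?_ _
    have := mem_of_expVec_mem (S := monomialExponents (Algebra.adjoin ℂ
        ({X 0 ^ r, X 0 ^ (r - a) * X 1, X 1 ^ r} ∪
          {q : MvPolynomial (Fin 2) ℂ | ∃ t s : ℕ, 1 ≤ t ∧ t ≤ n ∧ 2 ≤ s ∧ s ≤ α t - 1 ∧
            q = X 0 ^ (ser r a α (t - 1) - (s : ℤ) * ser r a α t).toNat *
                X 1 ^ ((s : ℤ) * ser 0 1 α t - ser 0 1 α (t - 1)).toNat})))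
      ha har hcop hn hα hval (q := ((d 0 : ℤ), (d 1 : ℤ)))
      ⟨hr.le, le_rfl, Algebra.subset_adjoin (by simp)⟩
      ⟨by simp only; omega, zero_le_one, Algebra.subset_adjoin (by
        simp [show ((r : ℤ) - a).toNat = r - a by omega])⟩
      ⟨le_rfl, hr.le, Algebra.subset_adjoin (by simp)⟩
      (fun t s ht hs hsα => ⟨(hnonneg t s ht hs hsα).1, (hnonneg t s ht hs hsα).2,
        Algebra.subset_adjoin (Or.inr ⟨t + 1, s, by omega, ht, hs, by omega, rfl⟩)⟩)
      (by simp) (by simp) (by simp only; exact_mod_cast hdvd)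
    simpa using this.2.2
  · intro hp
    refine Algebra.adjoin_le (S := AlgHom.equalizer (g : _ →ₐ[ℂ] _) (AlgHom.id ℂ _)) ?_ hp
    rintro q (hq | ⟨t, s, ht, htn, hs, hsα, rfl⟩)
    · show g q = q
      rcases hq with rfl | rfl | rfl
      · simpa using hinv r 0 (by simp)
      · simpa using hinv (r - a) 1 (by push_cast [har.le]; simp)
      · simpa using hinv 0 r (by simp)
    · obtain ⟨t, rfl⟩ : ∃ k, t = k + 1 := ⟨t - 1, by omega⟩
      obtain ⟨h1, h2⟩ := hnonneg t s htn hs (by omega)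
      refine hinv _ _ ?_
      have hdvd := dvd_expVec r a α t s
      simp only [expVec] at h1 h2 hdvd
      simpa only [Nat.add_sub_cancel, Int.toNat_of_nonneg h1, Int.toNat_of_nonneg h2] using hdvd
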